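/- Let d ≥ 1 be an integer, let B, δ ≥ 0, let A ⊂ ℝ be a Lebesgue measurable set with Lebesgue measure |A| ≤ δ, and let h: ℝ → ℝ be a measurable function with |h| ≤ B which vanishes outside A. Then for every x ∈ ℝ^d and every r ∈ [1,2]^d, ∫_{L_{x,r}} ∏_{i=1}^d |h(y_i)| dℋ¹(y) ≤ 2√d · B^d · δ. -/

import Mathlib

open MeasureTheory Set

/-- The line `L_{x,r} = {((z-x_1)/r_1, …, (z-x_d)/r_d) : z ∈ ℝ} ⊂ ℝ^d`. -/
def line (d : ℕ) (x r : Fin d → ℝ) : Set (EuclideanSpace ℝ (Fin d)) :=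
  {y | ∃ z : ℝ, ∀ i, y i = (z - x i) / r i}

/-- The points of the line `L_{x,r}` are determined by any one of their coordinates. -/
theorem mem_line_iff {d : ℕ} {x r : Fin d → ℝ} (i₀ : Fin d) (hr : ∀ i, r i ≠ 0)
    (y : EuclideanSpace ℝ (Fin d)) :
    y ∈ line d x r ↔ ∀ i, y i = (r i₀ * y i₀ + x i₀ - x i) / r i := by
  constructor
  · rintro ⟨z, hz⟩ i
    have hz₀ : r i₀ * y i₀ = z - x i₀ := by rw [hz i₀, mul_div_cancel₀ _ (hr i₀)]
    rw [hz i, hz₀, sub_add_cancel]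
  · exact fun hy ↦ ⟨r i₀ * y i₀ + x i₀, hy⟩

theorem measurableSet_line {d : ℕ} {x r : Fin d → ℝ} (i₀ : Fin d) (hr : ∀ i, r i ≠ 0) :
    MeasurableSet (line d x r) := by
  have hline : line d x r =
      ⋂ i, {y : EuclideanSpace ℝ (Fin d) | y i = (r i₀ * y i₀ + x i₀ - x i) / r i} := by
    ext y
    simp only [mem_line_iff i₀ hr, mem_iInter, mem_ofPred_eq]
  rw [hline]
  exact (isClosed_iInter fun i ↦ isClosed_eq (by fun_prop) (by fun_prop)).measurableSet

/-- The parametrization of the line `L_{x,r}` by the coordinate `i₀`. -/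
noncomputable def lineParam {d : ℕ} (x r : Fin d → ℝ) (i₀ : Fin d) (t : ℝ) :
    EuclideanSpace ℝ (Fin d) :=
  WithLp.toLp 2 fun i ↦ (r i₀ * t + x i₀ - x i) / r i

theorem lipschitzWith_lineParam {d : ℕ} (x : Fin d → ℝ) {r : Fin d → ℝ} (i₀ : Fin d)
    (hr : ∀ i, r i ∈ Icc (1 : ℝ) 2) :
    LipschitzWith (Real.toNNReal (2 * √d)) (lineParam x r i₀) := by
  refine LipschitzWith.of_dist_le_mul fun s t ↦ ?_
  rw [Real.coe_toNNReal _ (by positivity), EuclideanSpace.dist_eq]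
  have hcoord : ∀ i, dist (lineParam x r i₀ s i) (lineParam x r i₀ t i) ≤ 2 * dist s t := by
    intro i
    have hi : 0 < r i := by linarith [(hr i).1]
    have hi₀ : 0 < r i₀ := by linarith [(hr i₀).1]
    have hsub : lineParam x r i₀ s i - lineParam x r i₀ t i = r i₀ * (s - t) / r i := by
      simp only [lineParam]
      ring
    rw [Real.dist_eq, Real.dist_eq, hsub, abs_div, abs_mul, abs_of_pos hi, abs_of_pos hi₀]
    calc r i₀ * |s - t| / r i ≤ r i₀ * |s - t| := div_le_self (by positivity) (hr i).1
      _ ≤ 2 * |s - t| := by gcongr; exact (hr i₀).2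
  calc √(∑ i, dist (lineParam x r i₀ s i) (lineParam x r i₀ t i) ^ 2)
      ≤ √(∑ _i : Fin d, (2 * dist s t) ^ 2) := by gcongr with i; exact hcoord i
    _ = 2 * √d * dist s t := by
      rw [Finset.sum_const, Finset.card_univ, Fintype.card_fin, nsmul_eq_mul,
        Real.sqrt_mul (by positivity), Real.sqrt_sq (by positivity)]
      ring

/-- The part of the line `L_{x,r}` whose `i₀`-th coordinate lies in `A` has length at most
`2 √d |A|`. -/
theorem hausdorffMeasure_line_inter_le {d : ℕ} (x : Fin d → ℝ) {r : Fin d → ℝ} (i₀ : Fin d)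
    (hr : ∀ i, r i ∈ Icc (1 : ℝ) 2) (A : Set ℝ) :
    μH[1] (line d x r ∩ {y | y i₀ ∈ A}) ≤ ENNReal.ofReal (2 * √d) * volume A := by
  have hr₀ : ∀ i, r i ≠ 0 := fun i ↦ by linarith [(hr i).1]
  have hsub : line d x r ∩ {y | y i₀ ∈ A} ⊆ lineParam x r i₀ '' A := by
    rintro y ⟨hy, hyA⟩
    refine ⟨y i₀, hyA, ?_⟩
    ext i
    exact ((mem_line_iff i₀ hr₀ y).1 hy i).symm
  refine (measure_mono hsub).trans ?_
  have := (lipschitzWith_lineParam x i₀ hr).hausdorffMeasure_image_le zero_le_one A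
  rwa [hausdorffMeasure_real, ENNReal.rpow_one] at this

theorem stmt19 (d : ℕ) (hd : 1 ≤ d) (B δ : ℝ) (hB : 0 ≤ B) (hδ : 0 ≤ δ)
    (A : Set ℝ) (hA : MeasurableSet A) (hAvol : volume A ≤ ENNReal.ofReal δ)
    (h : ℝ → ℝ) (hm : Measurable h) (hb : ∀ t, |h t| ≤ B) (hv : ∀ t ∉ A, h t = 0)
    (x r : Fin d → ℝ) (hr : ∀ i, r i ∈ Icc (1 : ℝ) 2) :
    (∫ y in line d x r, ∏ i, |h (y i)| ∂μH[1]) ≤ 2 * Real.sqrt d * B ^ d * δ := by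
  let i₀ : Fin d := ⟨0, hd⟩
  have hr₀ : ∀ i, r i ≠ 0 := fun i ↦ by linarith [(hr i).1]
  set S : Set (EuclideanSpace ℝ (Fin d)) := line d x r ∩ {y | y i₀ ∈ A}
  have hS : μH[1] S ≤ ENNReal.ofReal (2 * √d * δ) := by
    rw [ENNReal.ofReal_mul (by positivity)]
    exact (hausdorffMeasure_line_inter_le x i₀ hr A).trans (by gcongr)
  have hbound : ∀ y ∈ S, ‖∏ i, |h (y i)|‖ ≤ B ^ d := by
    intro y _
    rw [Real.norm_of_nonneg (Finset.prod_nonneg fun i _ ↦ abs_nonneg _)]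
    simpa using Finset.prod_le_prod (s := Finset.univ) (fun i _ ↦ abs_nonneg (h (y i)))
      fun i _ ↦ hb (y i)
  have hzero : ∀ y ∈ line d x r \ S, ∏ i, |h (y i)| = 0 := by
    intro y hy
    refine Finset.prod_eq_zero (Finset.mem_univ i₀) ?_
    rw [hv _ fun hyA ↦ hy.2 ⟨hy.1, hyA⟩, abs_zero]
  rw [setIntegral_eq_of_subset_of_forall_sdiff_eq_zero (measurableSet_line i₀ hr₀)
    inter_subset_left hzero]
  calc ∫ y in S, ∏ i, |h (y i)| ∂μH[1]
      ≤ ‖∫ y in S, ∏ i, |h (y i)| ∂μH[1]‖ := Real.le_norm_self _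
    _ ≤ B ^ d * (μH[1] : Measure _).real S :=
      norm_setIntegral_le_of_norm_le_const (hS.trans_lt ENNReal.ofReal_lt_top) hbound
    _ ≤ B ^ d * (2 * √d * δ) := by
      gcongr
      exact ENNReal.toReal_le_of_le_ofReal (by positivity) hS
    _ = 2 * √d * B ^ d * δ := by ring
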